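/- For every smooth function u on B⁴ and every x ∈ B⁴, the Paneitz operator on B⁴ factors through the Euclidean bi-Laplacian: (−Δ_ℍ − 2)((−Δ_ℍ u))(x) = ((1 − |x|²)/2)⁴ · Δ(Δu)(x). -/

import Mathlib

open MeasureTheory Real

noncomputable section

/-- The Euclidean space `ℝ⁴`. -/
abbrev E4 := EuclideanSpace ℝ (Fin 4)

/-- The Euclidean Laplacian on `ℝ⁴`. -/
def lapE (u : E4 → ℝ) (x : E4) : ℝ :=
  ∑ i, fderiv ℝ (fun y => fderiv ℝ u y (EuclideanSpace.single i 1)) x (EuclideanSpace.single i 1)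

/-- The hyperbolic Laplacian on the Poincaré ball `B⁴`. -/
def hypLap (u : E4 → ℝ) (x : E4) : ℝ :=
  ((1 - ‖x‖ ^ 2) / 4) * ((1 - ‖x‖ ^ 2) * lapE u x + 4 * fderiv ℝ u x x)

end

open scoped ContDiff Topology

noncomputable section

/-- The `i`-th partial derivative of a function on `ℝ⁴`. -/
def partialDeriv (i : Fin 4) (f : E4 → ℝ) (x : E4) : ℝ :=
  fderiv ℝ f x (EuclideanSpace.single i 1)

/-- The Euler (radial) derivative `x · ∇f`. -/
def eulerDeriv (f : E4 → ℝ) (x : E4) : ℝ :=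
  fderiv ℝ f x x

end

variable {f g : E4 → ℝ} {x : E4}

lemma lapE_eq_sum_partialDeriv (f : E4 → ℝ) (x : E4) :
    lapE f x = ∑ i, partialDeriv i (partialDeriv i f) x := rfl

lemma eulerDeriv_eq_sum (f : E4 → ℝ) (x : E4) :
    eulerDeriv f x = ∑ j, x j * partialDeriv j f x := by
  have h : x = ∑ j, x j • EuclideanSpace.single j (1 : ℝ) := by
    ext k
    simp [Finset.sum_apply, Pi.single_apply]
  unfold eulerDeriv partialDeriv
  conv_lhs => rw [h, map_sum]
  rw [← h]
  simp

lemma ContDiffAt.eventually_contDiffAt_two (hf : ContDiffAt ℝ ∞ f x) :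
    ∀ᶠ y in 𝓝 x, ContDiffAt ℝ 2 f y :=
  (hf.of_le (WithTop.coe_le_coe.2 le_top) : ContDiffAt ℝ 2 f x).eventually (by simp)

lemma ContDiffAt.differentiableAt_of_smooth (hf : ContDiffAt ℝ ∞ f x) :
    DifferentiableAt ℝ f x :=
  hf.differentiableAt (by simp)

lemma ContDiffAt.partialDeriv (hf : ContDiffAt ℝ ∞ f x) (i : Fin 4) :
    ContDiffAt ℝ ∞ (partialDeriv i f) x :=
  (hf.fderiv_right (m := ∞) (by simp)).clm_apply contDiffAt_const

lemma ContDiffAt.eulerDeriv (hf : ContDiffAt ℝ ∞ f x) : ContDiffAt ℝ ∞ (eulerDeriv f) x :=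
  (hf.fderiv_right (m := ∞) (by simp)).clm_apply contDiffAt_id

lemma ContDiffAt.lapE (hf : ContDiffAt ℝ ∞ f x) : ContDiffAt ℝ ∞ (lapE f) x :=
  ContDiffAt.sum fun i _ => (hf.partialDeriv i).partialDeriv i

lemma partialDeriv_congr (h : f =ᶠ[𝓝 x] g) (i : Fin 4) :
    partialDeriv i f x = partialDeriv i g x := by
  simp only [partialDeriv, h.fderiv_eq]

lemma partialDeriv_add (hf : DifferentiableAt ℝ f x) (hg : DifferentiableAt ℝ g x) (i : Fin 4) :
    partialDeriv i (fun y => f y + g y) x = partialDeriv i f x + partialDeriv i g x := by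
  simp [partialDeriv, fderiv_fun_add hf hg]

lemma partialDeriv_mul (hf : DifferentiableAt ℝ f x) (hg : DifferentiableAt ℝ g x) (i : Fin 4) :
    partialDeriv i (fun y => f y * g y) x
      = f x * partialDeriv i g x + g x * partialDeriv i f x := by
  simp [partialDeriv, fderiv_fun_mul hf hg]

lemma partialDeriv_sum {F : Fin 4 → E4 → ℝ} (hF : ∀ j, DifferentiableAt ℝ (F j) x) (i : Fin 4) :
    partialDeriv i (fun y => ∑ j, F j y) x = ∑ j, partialDeriv i (F j) x := by
  simp [partialDeriv, fderiv_fun_sum fun j _ => hF j]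

lemma partialDeriv_const (c : ℝ) (i : Fin 4) (x : E4) : partialDeriv i (fun _ => c) x = 0 := by
  simp [partialDeriv]

lemma partialDeriv_coord (i j : Fin 4) (x : E4) :
    partialDeriv i (fun y => y j) x = if j = i then 1 else 0 := by
  have h : HasFDerivAt (fun y : E4 => y j) (EuclideanSpace.proj j : E4 →L[ℝ] ℝ) x :=
    (EuclideanSpace.proj j : E4 →L[ℝ] ℝ).hasFDerivAt
  simp [partialDeriv, h.fderiv]

lemma contDiffAt_coord (j : Fin 4) (x : E4) : ContDiffAt ℝ ∞ (fun y : E4 => y j) x :=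
  (EuclideanSpace.proj j : E4 →L[ℝ] ℝ).contDiff.contDiffAt

lemma partialDeriv_comm (hf : ContDiffAt ℝ 2 f x) (i j : Fin 4) :
    partialDeriv i (partialDeriv j f) x = partialDeriv j (partialDeriv i f) x := by
  have hd : DifferentiableAt ℝ (fderiv ℝ f) x :=
    (hf.fderiv_right (m := 1) (by norm_num)).differentiableAt (by simp)
  have key : ∀ k l : Fin 4, partialDeriv k (partialDeriv l f) x
      = fderiv ℝ (fderiv ℝ f) x (EuclideanSpace.single k 1) (EuclideanSpace.single l 1) := by
    intro k l
    change fderiv ℝ (fun y => fderiv ℝ f y (EuclideanSpace.single l 1)) x _ = _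
    rw [fderiv_clm_apply hd (differentiableAt_const _)]
    simp
  rw [key, key]
  exact (hf.isSymmSndFDerivAt (by simp)).eq _ _

lemma lapE_add (hf : ContDiffAt ℝ ∞ f x) (hg : ContDiffAt ℝ ∞ g x) :
    lapE (fun y => f y + g y) x = lapE f x + lapE g x := by
  simp only [lapE_eq_sum_partialDeriv, ← Finset.sum_add_distrib]
  refine Finset.sum_congr rfl fun i _ => ?_
  rw [← partialDeriv_add (hf.partialDeriv i).differentiableAt_of_smooth
    (hg.partialDeriv i).differentiableAt_of_smooth]
  refine partialDeriv_congr ?_ i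
  filter_upwards [hf.eventually_contDiffAt_two, hg.eventually_contDiffAt_two] with y hfy hgy
  exact partialDeriv_add (hfy.differentiableAt (by simp)) (hgy.differentiableAt (by simp)) i

lemma lapE_sum {F : Fin 4 → E4 → ℝ} (hF : ∀ j, ContDiffAt ℝ ∞ (F j) x) :
    lapE (fun y => ∑ j, F j y) x = ∑ j, lapE (F j) x := by
  simp only [lapE_eq_sum_partialDeriv]
  rw [Finset.sum_comm]
  refine Finset.sum_congr rfl fun i _ => ?_
  rw [← partialDeriv_sum fun j => ((hF j).partialDeriv i).differentiableAt_of_smooth]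
  refine partialDeriv_congr ?_ i
  filter_upwards [Filter.eventually_all.2 fun j => (hF j).eventually_contDiffAt_two] with y hy
  exact partialDeriv_sum (fun j => (hy j).differentiableAt (by simp)) i

lemma lapE_mul (hf : ContDiffAt ℝ ∞ f x) (hg : ContDiffAt ℝ ∞ g x) :
    lapE (fun y => f y * g y) x
      = f x * lapE g x + g x * lapE f x + 2 * ∑ i, partialDeriv i f x * partialDeriv i g x := by
  simp only [lapE_eq_sum_partialDeriv, Finset.mul_sum, ← Finset.sum_add_distrib]
  refine Finset.sum_congr rfl fun i _ => ?_
  have h : partialDeriv i (fun y => f y * g y)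
      =ᶠ[𝓝 x] fun y => f y * partialDeriv i g y + g y * partialDeriv i f y := by
    filter_upwards [hf.eventually_contDiffAt_two, hg.eventually_contDiffAt_two] with y hfy hgy
    exact partialDeriv_mul (hfy.differentiableAt (by simp)) (hgy.differentiableAt (by simp)) i
  have hf' := hf.differentiableAt_of_smooth
  have hg' := hg.differentiableAt_of_smooth
  have hfi := (hf.partialDeriv i).differentiableAt_of_smooth
  have hgi := (hg.partialDeriv i).differentiableAt_of_smooth
  rw [partialDeriv_congr h, partialDeriv_add (hf'.fun_mul hgi) (hg'.fun_mul hfi),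
    partialDeriv_mul hf' hgi, partialDeriv_mul hg' hfi]
  ring

lemma lapE_const_mul (c : ℝ) (hf : ContDiffAt ℝ ∞ f x) :
    lapE (fun y => c * f y) x = c * lapE f x := by
  have hc : ∀ i, partialDeriv i (fun _ => c) = fun _ => 0 := fun i =>
    funext (partialDeriv_const c i)
  rw [lapE_mul contDiffAt_const hf, lapE_eq_sum_partialDeriv (fun _ => c)]
  simp [hc, partialDeriv_const]

lemma lapE_partialDeriv (hf : ContDiffAt ℝ ∞ f x) (j : Fin 4) :
    lapE (partialDeriv j f) x = partialDeriv j (lapE f) x := by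
  have h : partialDeriv j (lapE f) x = ∑ i, partialDeriv j (partialDeriv i (partialDeriv i f)) x :=
    partialDeriv_sum
      (fun i => ((hf.partialDeriv i).partialDeriv i).differentiableAt_of_smooth) j
  rw [h, lapE_eq_sum_partialDeriv]
  refine Finset.sum_congr rfl fun i _ => ?_
  rw [partialDeriv_comm (hf.partialDeriv i).eventually_contDiffAt_two.self_of_nhds j i]
  refine partialDeriv_congr ?_ i
  filter_upwards [hf.eventually_contDiffAt_two] with y hy
  exact partialDeriv_comm hy i j

lemma lapE_coord (j : Fin 4) (x : E4) : lapE (fun y => y j) x = 0 := by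
  have h : ∀ i, partialDeriv i (fun y => y j) = fun _ => if j = i then 1 else 0 := fun i =>
    funext (partialDeriv_coord i j)
  simp only [lapE_eq_sum_partialDeriv, h, partialDeriv_const, Finset.sum_const_zero]

lemma lapE_eulerDeriv (hf : ContDiffAt ℝ ∞ f x) :
    lapE (eulerDeriv f) x = eulerDeriv (lapE f) x + 2 * lapE f x := by
  rw [funext (eulerDeriv_eq_sum f),
    lapE_sum fun j => (contDiffAt_coord j x).mul (hf.partialDeriv j), eulerDeriv_eq_sum,
    lapE_eq_sum_partialDeriv f, Finset.mul_sum, ← Finset.sum_add_distrib]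
  refine Finset.sum_congr rfl fun j _ => ?_
  rw [lapE_mul (contDiffAt_coord j x) (hf.partialDeriv j), lapE_coord, lapE_partialDeriv hf]
  simp [partialDeriv_coord]

lemma eulerDeriv_add (hf : DifferentiableAt ℝ f x) (hg : DifferentiableAt ℝ g x) :
    eulerDeriv (fun y => f y + g y) x = eulerDeriv f x + eulerDeriv g x := by
  simp [eulerDeriv, fderiv_fun_add hf hg]

lemma eulerDeriv_mul (hf : DifferentiableAt ℝ f x) (hg : DifferentiableAt ℝ g x) :
    eulerDeriv (fun y => f y * g y) x = f x * eulerDeriv g x + g x * eulerDeriv f x := by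
  simp [eulerDeriv, fderiv_fun_mul hf hg]

lemma eulerDeriv_const_mul (c : ℝ) (hf : DifferentiableAt ℝ f x) :
    eulerDeriv (fun y => c * f y) x = c * eulerDeriv f x := by
  simp [eulerDeriv, fderiv_const_mul hf]

lemma contDiffAt_one_sub_norm_sq (x : E4) : ContDiffAt ℝ ∞ (fun y : E4 => 1 - ‖y‖ ^ 2) x :=
  contDiffAt_const.sub (contDiff_norm_sq ℝ).contDiffAt

lemma fderiv_one_sub_norm_sq (x v : E4) :
    fderiv ℝ (fun y : E4 => 1 - ‖y‖ ^ 2) x v = -2 * inner ℝ x v := by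
  rw [fderiv_const_sub, fderiv_norm_sq_apply]
  simp

lemma partialDeriv_one_sub_norm_sq (i : Fin 4) (x : E4) :
    partialDeriv i (fun y => 1 - ‖y‖ ^ 2) x = -2 * x i := by
  simp [partialDeriv, fderiv_one_sub_norm_sq, EuclideanSpace.inner_single_right]

lemma eulerDeriv_one_sub_norm_sq (x : E4) :
    eulerDeriv (fun y => 1 - ‖y‖ ^ 2) x = -2 * ‖x‖ ^ 2 := by
  rw [eulerDeriv, fderiv_one_sub_norm_sq, real_inner_self_eq_norm_sq]

lemma lapE_one_sub_norm_sq (x : E4) : lapE (fun y => 1 - ‖y‖ ^ 2) x = -8 := by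
  have h : ∀ i, partialDeriv i (fun y => 1 - ‖y‖ ^ 2) = fun y => -2 * y i := fun i =>
    funext (partialDeriv_one_sub_norm_sq i)
  have h' : ∀ i, partialDeriv i (fun y => -2 * y i) x = -2 := fun i => by
    rw [partialDeriv_mul (differentiableAt_const _)
      (contDiffAt_coord i x).differentiableAt_of_smooth, partialDeriv_const, partialDeriv_coord]
    simp
  simp only [lapE_eq_sum_partialDeriv, h, h']
  norm_num

lemma lapE_one_sub_norm_sq_mul (hf : ContDiffAt ℝ ∞ f x) :
    lapE (fun y => (1 - ‖y‖ ^ 2) * f y) x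
      = (1 - ‖x‖ ^ 2) * lapE f x - 8 * f x - 4 * eulerDeriv f x := by
  rw [lapE_mul (contDiffAt_one_sub_norm_sq x) hf, lapE_one_sub_norm_sq, eulerDeriv_eq_sum]
  simp only [partialDeriv_one_sub_norm_sq, mul_assoc, ← Finset.mul_sum]
  ring

lemma eulerDeriv_one_sub_norm_sq_mul (hf : ContDiffAt ℝ ∞ f x) :
    eulerDeriv (fun y => (1 - ‖y‖ ^ 2) * f y) x
      = (1 - ‖x‖ ^ 2) * eulerDeriv f x - 2 * ‖x‖ ^ 2 * f x := by
  rw [eulerDeriv_mul (contDiffAt_one_sub_norm_sq x).differentiableAt_of_smooth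
    hf.differentiableAt_of_smooth, eulerDeriv_one_sub_norm_sq]
  ring

lemma hypLap_eq (f : E4 → ℝ) (x : E4) :
    hypLap f x = (1 - ‖x‖ ^ 2) / 4 * ((1 - ‖x‖ ^ 2) * lapE f x + 4 * eulerDeriv f x) := rfl

theorem paneitz_factorization (u : E4 → ℝ)
    (hu : ContDiffOn ℝ (⊤ : ℕ∞) u (Metric.ball (0 : E4) 1))
    (x : E4) (hx : x ∈ Metric.ball (0 : E4) 1) :
    -(hypLap (fun y => -(hypLap u y)) x) - 2 * (-(hypLap u x))
      = ((1 - ‖x‖ ^ 2) / 2) ^ 4 * lapE (fun y => lapE u y) x := by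
  have hux : ContDiffAt ℝ ∞ u x := hu.contDiffAt (Metric.isOpen_ball.mem_nhds hx)
  have hw : (fun y => -(hypLap u y)) = fun y => (-1 / 4 : ℝ) *
      ((1 - ‖y‖ ^ 2) * ((1 - ‖y‖ ^ 2) * lapE u y + 4 * eulerDeriv u y)) := by
    funext y
    rw [hypLap_eq]
    ring
  have hρ := contDiffAt_one_sub_norm_sq x
  have he : ContDiffAt ℝ ∞ (fun y => 4 * eulerDeriv u y) x := contDiffAt_const.mul hux.eulerDeriv
  have hρD := hρ.mul hux.lapE
  have hh := hρD.add he
  have hρh := hρ.mul hh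
  rw [hw, hypLap_eq, hypLap_eq, lapE_const_mul _ hρh,
    eulerDeriv_const_mul _ hρh.differentiableAt_of_smooth,
    lapE_one_sub_norm_sq_mul hh, eulerDeriv_one_sub_norm_sq_mul hh, lapE_add hρD he,
    eulerDeriv_add hρD.differentiableAt_of_smooth he.differentiableAt_of_smooth,
    lapE_one_sub_norm_sq_mul hux.lapE, eulerDeriv_one_sub_norm_sq_mul hux.lapE,
    lapE_const_mul _ hux.eulerDeriv,
    eulerDeriv_const_mul _ hux.eulerDeriv.differentiableAt_of_smooth, lapE_eulerDeriv hux]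
  change _ = _ * lapE (lapE u) x
  ring
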